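/- arXiv:2302.05500 — 4 statements merged into one kernel-verified Lean document; each statement's English description precedes it below -/
import Mathlib

section
/- For every bounded continuous φ: [0,∞) → ℝ, every t > 0, and every x > 0, the function s ↦ (S(s)φ)(x) is differentiable at s = t and its derivative satisfies |∂_t (S(t)φ)(x)| ≤ (1 + μt)·e^{−μt}·‖φ‖ / t. -/
open Set Real MeasureTheory

/-- The Dirichlet heat kernel on the half-line:
`G(t,x,y) = (4πt)^{-1/2} (exp(-(x-y)²/(4t)) - exp(-(x+y)²/(4t)))`. -/
noncomputable def heatG (t x y : ℝ) : ℝ :=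
  (1 / Real.sqrt (4 * Real.pi * t)) *
    (Real.exp (-(x - y) ^ 2 / (4 * t)) - Real.exp (-(x + y) ^ 2 / (4 * t)))

/-- The semigroup `(S(t)φ)(x) = e^{-μt} ∫₀^∞ G(t,x,y) φ(y) dy`, with `S(0)φ = φ`. -/
noncomputable def heatS (μ t : ℝ) (φ : ℝ → ℝ) (x : ℝ) : ℝ :=
  if t = 0 then φ x
  else Real.exp (-μ * t) * ∫ y in Set.Ioi (0:ℝ), heatG t x y * φ y

/-- The supremum norm `‖φ‖ = sup_{x ≥ 0} |φ x|`. -/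
noncomputable def supnorm (φ : ℝ → ℝ) : ℝ := ⨆ x : Set.Ici (0:ℝ), |φ (x : ℝ)|


noncomputable def pker (s z : ℝ) : ℝ := (1 / Real.sqrt (4 * Real.pi * s)) * Real.exp (-z ^ 2 / (4 * s))

lemma pker_nonneg (s z : ℝ) : 0 ≤ pker s z := by unfold pker; positivity

lemma heatG_eq (s x y : ℝ) : heatG s x y = pker s (x - y) - pker s (x + y) := by
  unfold heatG pker; ring

lemma pker_cont (s : ℝ) : Continuous (pker s) := by
  unfold pker; fun_prop

lemma pker_deriv (s z : ℝ) (hs : 0 < s) :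
    HasDerivAt (fun s => pker s z) (pker s z * (z ^ 2 / (4 * s ^ 2) - 1 / (2 * s))) s := by
  unfold pker
  have h0 : 0 < 4 * Real.pi * s := by positivity
  have hq : 0 < Real.sqrt (4 * Real.pi * s) := Real.sqrt_pos.2 h0
  have hsq : Real.sqrt (4 * Real.pi * s) ^ 2 = 4 * Real.pi * s := Real.sq_sqrt h0.le
  have h1 : HasDerivAt (fun s : ℝ => 4 * Real.pi * s) (4 * Real.pi) s := by
    simpa using (hasDerivAt_id s).const_mul (4 * Real.pi)
  have h2 := (h1.sqrt h0.ne').inv hq.ne'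
  have h3 : HasDerivAt (fun s : ℝ => 4 * s) 4 s := by
    simpa using (hasDerivAt_id s).const_mul (4 : ℝ)
  have h4 := ((hasDerivAt_const s (-z ^ 2)).div h3 (by positivity)).exp
  have h5 := h2.mul h4
  refine (h5.congr_of_eventuallyEq (f₁ := fun s => (1 / Real.sqrt (4 * Real.pi * s)) *
    Real.exp (-z ^ 2 / (4 * s))) ?_).congr_deriv ?_
  · exact Filter.Eventually.of_forall fun s => by simp
  · simp only [hsq, Pi.div_apply, Pi.inv_apply]
    set q := Real.sqrt (4 * Real.pi * s)
    set E := Real.exp (-z ^ 2 / (4 * s))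
    field_simp
    ring

lemma pker_gauss (s z : ℝ) (hs : 0 < s) :
    pker s z = ProbabilityTheory.gaussianPDFReal 0 (2 * s).toNNReal z := by
  unfold pker ProbabilityTheory.gaussianPDFReal
  rw [Real.coe_toNNReal _ (by positivity)]
  rw [one_div]
  congr 2
  · congr 1; ring
  · ring_nf

lemma v_ne (s : ℝ) (hs : 0 < s) : (2 * s).toNNReal ≠ 0 := by
  simp [hs]

lemma pker_int (s : ℝ) (hs : 0 < s) : Integrable (pker s) := by
  rw [show pker s = _ from funext fun z => pker_gauss s z hs]
  exact ProbabilityTheory.integrable_gaussianPDFReal _ _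

lemma pker_integral (s : ℝ) (hs : 0 < s) : ∫ z, pker s z = 1 := by
  rw [show pker s = _ from funext fun z => pker_gauss s z hs]
  exact ProbabilityTheory.integral_gaussianPDFReal_eq_one _ (v_ne s hs)

lemma pker_integral2 (s : ℝ) (hs : 0 < s) : ∫ z, pker s z * z ^ 2 = 2 * s := by
  have h := ProbabilityTheory.variance_fun_id_gaussianReal (μ := 0) (v := (2 * s).toNNReal)
  rw [ProbabilityTheory.variance_eq_integral (by fun_prop),
    ProbabilityTheory.integral_gaussianReal_eq_integral_smul (v_ne s hs),
    Real.coe_toNNReal _ (by positivity)] at h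
  simpa [← pker_gauss s _ hs] using h

lemma pker_int2 (s : ℝ) (hs : 0 < s) : Integrable (fun z => pker s z * z ^ 2) := by
  by_contra h
  have := pker_integral2 s hs
  rw [integral_undef h] at this
  linarith

lemma fold_int (f : ℝ → ℝ) (hf : Integrable f) (x : ℝ) :
    IntegrableOn (fun y => f (x - y) + f (x + y)) (Ioi 0) :=
  ((hf.comp_sub_left x).add (hf.comp_add_left x)).integrableOn

lemma fold_integral (f : ℝ → ℝ) (hf : Integrable f) (x : ℝ) :
    ∫ y in Ioi (0:ℝ), (f (x - y) + f (x + y)) = ∫ z, f z := by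
  rw [integral_add (hf.comp_sub_left x).integrableOn (hf.comp_add_left x).integrableOn]
  have h := integral_comp_neg_Ioi 0 (fun y => f (x - y))
  simp only [sub_neg_eq_add, neg_zero] at h
  rw [h, add_comm, intervalIntegral.integral_Iic_add_Ioi (hf.comp_sub_left x).integrableOn
    (hf.comp_sub_left x).integrableOn, integral_sub_left_eq_self]

lemma pker_dom (s t z : ℝ) (ht : 0 < t) (h1 : t / 2 < s) (h2 : s < 2 * t) :
    pker s z ≤ 2 * pker (2 * t) z := by
  have hs : 0 < s := by linarith
  unfold pker
  rw [← mul_assoc]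
  have e : Real.sqrt (4 * Real.pi * (2 * t)) = 2 * Real.sqrt (2 * Real.pi * t) := by
    rw [show 4 * Real.pi * (2 * t) = 2 ^ 2 * (2 * Real.pi * t) by ring,
      Real.sqrt_mul (by positivity), Real.sqrt_sq (by positivity)]
  rw [e, show 2 * (1 / (2 * Real.sqrt (2 * Real.pi * t))) = 1 / Real.sqrt (2 * Real.pi * t) by
    field_simp]
  gcongr ?_ * ?_
  · apply one_div_le_one_div_of_le (by positivity)
    apply Real.sqrt_le_sqrt
    nlinarith [Real.pi_pos]
  · apply Real.exp_le_exp.2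
    rw [neg_div, neg_div, neg_le_neg_iff]
    gcongr

noncomputable def kd (s z : ℝ) : ℝ := pker s z * (z ^ 2 / (4 * s ^ 2) - 1 / (2 * s))

noncomputable def kb (s z : ℝ) : ℝ := pker s z * (z ^ 2 / (4 * s ^ 2) + 1 / (2 * s))

noncomputable def kc (t z : ℝ) : ℝ := 2 * pker (2 * t) z * (z ^ 2 / t ^ 2 + 1 / t)

lemma kd_le (s z : ℝ) (hs : 0 < s) : |kd s z| ≤ kb s z := by
  unfold kd kb
  rw [abs_mul, abs_of_nonneg (pker_nonneg s z)]
  apply mul_le_mul_of_nonneg_left _ (pker_nonneg s z)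
  have a : 0 ≤ z ^ 2 / (4 * s ^ 2) := by positivity
  have b : 0 ≤ 1 / (2 * s) := by positivity
  rw [abs_le]; constructor <;> linarith

lemma kb_le (s t z : ℝ) (ht : 0 < t) (h1 : t / 2 < s) (h2 : s < 2 * t) : kb s z ≤ kc t z := by
  have hs : 0 < s := by linarith
  unfold kb kc
  have := pker_nonneg (2 * t) z
  gcongr ?_ * (?_ + ?_)
  · exact pker_dom s t z ht h1 h2
  · gcongr
    nlinarith
  · gcongr
    linarith

lemma kb_int (s : ℝ) (hs : 0 < s) : Integrable (kb s) := by
  have := ((pker_int2 s hs).const_mul (1 / (4 * s ^ 2))).add ((pker_int s hs).const_mul (1 / (2 * s)))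
  refine this.congr (Filter.Eventually.of_forall fun z => ?_)
  simp [kb]; ring

lemma kc_int (t : ℝ) (ht : 0 < t) : Integrable (kc t) := by
  have := ((pker_int2 (2 * t) (by positivity)).const_mul (2 / t ^ 2)).add
    ((pker_int (2 * t) (by positivity)).const_mul (2 / t))
  refine this.congr (Filter.Eventually.of_forall fun z => ?_)
  simp [kc]; ring

lemma kb_integral (s : ℝ) (hs : 0 < s) : ∫ z, kb s z = 1 / s := by
  have e : kb s = fun z => (1 / (4 * s ^ 2)) * (pker s z * z ^ 2) + (1 / (2 * s)) * pker s z := by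
    ext z; simp [kb]; ring
  rw [e, integral_add ((pker_int2 s hs).const_mul _) ((pker_int s hs).const_mul _),
    integral_const_mul, integral_const_mul, pker_integral2 s hs, pker_integral s hs]
  field_simp; norm_num

lemma kd_cont (s : ℝ) : Continuous (kd s) := by
  have := pker_cont s
  unfold kd; fun_prop

/-- Lemma 3.1 (iii), time-derivative estimate: for `t > 0` and `x > 0`, the map
`s ↦ (S(s)φ)(x)` is differentiable at `t` and
`|∂_t (S(t)φ)(x)| ≤ (1 + μt) e^{-μt} ‖φ‖ / t`. -/
theorem stmt_5 (μ : ℝ) (hμ : 0 < μ) (φ : ℝ → ℝ)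
    (hcont : ContinuousOn φ (Set.Ici 0))
    (hbdd : ∃ M, ∀ x ≥ (0:ℝ), |φ x| ≤ M) :
    ∀ t > (0:ℝ), ∀ x > (0:ℝ),
      DifferentiableAt ℝ (fun s => heatS μ s φ x) t ∧
      |deriv (fun s => heatS μ s φ x) t| ≤
        (1 + μ * t) * Real.exp (-μ * t) * supnorm φ / t := by
  intro t ht x hx
  obtain ⟨M, hM⟩ := hbdd
  have hN : ∀ y ∈ Ioi (0:ℝ), |φ y| ≤ supnorm φ := by
    intro y hy
    refine le_ciSup (f := fun x : Set.Ici (0:ℝ) => |φ (x : ℝ)|) ?_ ⟨y, mem_Ici.2 (le_of_lt hy)⟩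
    exact ⟨M, by rintro _ ⟨z, rfl⟩; exact hM z z.2⟩
  have hN0 : 0 ≤ supnorm φ := (abs_nonneg _).trans (hN 1 (by simp))
  set N := supnorm φ
  have hφm : AEStronglyMeasurable φ (volume.restrict (Ioi 0)) :=
    (hcont.mono Ioi_subset_Ici_self).aestronglyMeasurable measurableSet_Ioi
  have hGm : ∀ s, AEStronglyMeasurable (fun y => heatG s x y * φ y) (volume.restrict (Ioi 0)) := by
    intro s
    refine AEStronglyMeasurable.mul (Continuous.aestronglyMeasurable ?_) hφm
    have := pker_cont s
    rw [show heatG s x = _ from funext fun y => heatG_eq s x y]; fun_prop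
  have hGb : ∀ y ∈ Ioi (0:ℝ), ‖heatG t x y * φ y‖ ≤ (pker t (x - y) + pker t (x + y)) * N := by
    intro y hy
    rw [norm_mul, Real.norm_eq_abs, Real.norm_eq_abs, heatG_eq]
    have a := pker_nonneg t (x - y)
    have b := pker_nonneg t (x + y)
    apply mul_le_mul _ (hN y hy) (abs_nonneg _) (by positivity)
    rw [abs_le]; constructor <;> linarith
  have hDb : ∀ s > 0, ∀ y ∈ Ioi (0:ℝ), ‖(kd s (x - y) - kd s (x + y)) * φ y‖ ≤
      (kb s (x - y) + kb s (x + y)) * N := by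
    intro s hs y hy
    rw [norm_mul, Real.norm_eq_abs, Real.norm_eq_abs]
    have a := kd_le s (x - y) hs
    have b := kd_le s (x + y) hs
    have a' := abs_nonneg (kd s (x - y))
    have b' := abs_nonneg (kd s (x + y))
    apply mul_le_mul _ (hN y hy) (abs_nonneg _) (by linarith)
    exact (abs_sub _ _).trans (by linarith)
  have hGbi := (fold_int _ (pker_int t ht) x).mul_const N
  have key := hasDerivAt_integral_of_dominated_loc_of_deriv_le
    (μ := volume.restrict (Ioi (0:ℝ))) (s := Ioo (t / 2) (2 * t)) (x₀ := t)
    (F := fun s y => heatG s x y * φ y)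
    (F' := fun s y => (kd s (x - y) - kd s (x + y)) * φ y)
    (bound := fun y => (kc t (x - y) + kc t (x + y)) * N)
    (Ioo_mem_nhds (by linarith) (by linarith))
    (Filter.Eventually.of_forall hGm)
    (hGbi.mono' (hGm t) ((ae_restrict_iff' measurableSet_Ioi).2 (Filter.Eventually.of_forall hGb)))
    (by
      refine AEStronglyMeasurable.mul (Continuous.aestronglyMeasurable ?_) hφm
      have := kd_cont t
      fun_prop)
    ((ae_restrict_iff' measurableSet_Ioi).2 (Filter.Eventually.of_forall (by
      intro y hy s hs
      refine (hDb s (by linarith [hs.1]) y hy).trans ?_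
      have := kb_le s t (x - y) ht hs.1 hs.2
      have := kb_le s t (x + y) ht hs.1 hs.2
      gcongr)))
    ((fold_int _ (kc_int t ht) x).mul_const N)
    (Filter.Eventually.of_forall (by
      intro y s hs
      have hs0 : 0 < s := by linarith [hs.1]
      simp only [heatG_eq]
      exact ((pker_deriv s _ hs0).sub (pker_deriv s _ hs0)).mul_const _))
  have hI : |∫ y in Ioi (0:ℝ), heatG t x y * φ y| ≤ N := by
    have := norm_integral_le_of_norm_le hGbi
      ((ae_restrict_iff' measurableSet_Ioi).2 (Filter.Eventually.of_forall hGb))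
    rwa [integral_mul_const, fold_integral _ (pker_int t ht), pker_integral t ht, one_mul] at this
  have hI' : |∫ y in Ioi (0:ℝ), (kd t (x - y) - kd t (x + y)) * φ y| ≤ 1 / t * N := by
    have := norm_integral_le_of_norm_le ((fold_int _ (kb_int t ht) x).mul_const N)
      ((ae_restrict_iff' measurableSet_Ioi).2 (Filter.Eventually.of_forall (hDb t ht)))
    rwa [integral_mul_const, fold_integral _ (kb_int t ht), kb_integral t ht] at this
  have he : HasDerivAt (fun s => Real.exp (-μ * s)) (Real.exp (-μ * t) * (-μ)) t := by
    have : HasDerivAt (fun s : ℝ => -μ * s) (-μ) t := by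
      simpa using (hasDerivAt_id t).const_mul (-μ)
    exact this.exp
  have hd := he.mul key.2
  have hev : (fun s => heatS μ s φ x) =ᶠ[nhds t]
      ((fun s => Real.exp (-μ * s)) * fun n => ∫ a in Ioi (0:ℝ), heatG n x a * φ a) := by
    filter_upwards [lt_mem_nhds ht] with s hs
    simp [heatS, hs.ne']
  have hS := hd.congr_of_eventuallyEq hev
  refine ⟨hS.differentiableAt, ?_⟩
  rw [hS.deriv]
  set I := ∫ y in Ioi (0:ℝ), heatG t x y * φ y
  set I' := ∫ y in Ioi (0:ℝ), (kd t (x - y) - kd t (x + y)) * φ y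
  set E := Real.exp (-μ * t)
  have hE : 0 < E := Real.exp_pos _
  calc |E * (-μ) * I + E * I'| ≤ |E * (-μ) * I| + |E * I'| := abs_add_le _ _
    _ = E * (μ * |I| + |I'|) := by
      rw [abs_mul, abs_mul, abs_mul, abs_neg, abs_of_pos hE, abs_of_pos hμ]; ring
    _ ≤ E * (μ * N + 1 / t * N) := by gcongr
    _ = _ := by field_simp; ring
end

section
/- For every bounded continuous φ: [0,∞) → ℝ and every t > 0, the function x ↦ (S(t)φ)(x) is differentiable on (0,∞) and its derivative satisfies |∂_x (S(t)φ)(x)| ≤ e^{−μt}·‖φ‖ / √(πt) for all x > 0. -/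
open Set Real MeasureTheory

theorem aux_abs_int {b : ℝ} (hb : 0 < b) :
    ∫ z : ℝ, |z| * Real.exp (-b * z ^ 2) = 1 / b := by
  have h1 : ∫ z : ℝ, |z| * Real.exp (-b * z ^ 2)
      = ∫ z : ℝ, (fun r : ℝ => r * Real.exp (-b * r ^ 2)) |z| := by
    simp only [sq_abs]
  rw [h1, integral_comp_abs (f := fun r : ℝ => r * Real.exp (-b * r ^ 2))]
  have h2 := integral_rpow_mul_exp_neg_mul_rpow (p := 2) (q := 1) (b := b)
    (by norm_num) (by norm_num) hb
  have h3 : ∫ x in Ioi (0 : ℝ), x * Real.exp (-b * x ^ 2) = b⁻¹ * (1 / 2) := by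
    have : (-(1 + 1) / 2 : ℝ) = -1 := by norm_num
    rw [this] at h2
    have h4 : ((1 + 1) / 2 : ℝ) = 1 := by norm_num
    rw [h4, Real.Gamma_one, Real.rpow_neg_one] at h2
    simpa using h2
  rw [h3]
  field_simp

theorem aux_abs_integrable {b : ℝ} (hb : 0 < b) :
    Integrable (fun z : ℝ => |z| * Real.exp (-b * z ^ 2)) := by
  have := (integrable_mul_exp_neg_mul_sq hb).norm
  simpa [abs_mul] using this

theorem aux_bound {b : ℝ} (hb : 0 < b) (x x₀ y : ℝ) (hx : |x - x₀| ≤ 1) :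
    |x - y| * Real.exp (-b * (x - y) ^ 2) ≤
      (1 + 2 / b) * Real.exp (b / 2) * Real.exp (-(b / 4) * (x₀ - y) ^ 2) := by
  have hu : |x - y| ≤ (1 + 2 / b) * Real.exp (b / 2 * (x - y) ^ 2) := by
    have h1 := Real.add_one_le_exp (b / 2 * (x - y) ^ 2)
    have h2 : |x - y| ≤ 1 + (x - y) ^ 2 := by
      rw [← sq_abs (x - y)]
      nlinarith [sq_nonneg (|x - y| - 1), abs_nonneg (x - y)]
    have h3 : (1 + 2 / b) * (b / 2 * (x - y) ^ 2 + 1)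
        = 1 + (x - y) ^ 2 + (b / 2 * (x - y) ^ 2 + 2 / b) := by
      field_simp; ring
    have h4 : 0 ≤ b / 2 * (x - y) ^ 2 + 2 / b := by positivity
    have h5 : (1 + 2 / b) * (b / 2 * (x - y) ^ 2 + 1)
        ≤ (1 + 2 / b) * Real.exp (b / 2 * (x - y) ^ 2) := by gcongr
    linarith
  have hsq : (x - x₀) ^ 2 ≤ 1 := by
    rw [← sq_abs]; nlinarith [abs_nonneg (x - x₀)]
  have he : b / 2 * (x - y) ^ 2 + -b * (x - y) ^ 2 ≤ b / 2 + -(b / 4) * (x₀ - y) ^ 2 := by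
    have : (x₀ - y) ^ 2 ≤ 2 * (x - y) ^ 2 + 2 := by
      nlinarith [sq_nonneg ((x - y) + (x - x₀))]
    nlinarith
  calc |x - y| * Real.exp (-b * (x - y) ^ 2)
      ≤ (1 + 2 / b) * Real.exp (b / 2 * (x - y) ^ 2) * Real.exp (-b * (x - y) ^ 2) := by gcongr
    _ = (1 + 2 / b) * Real.exp (b / 2 * (x - y) ^ 2 + -b * (x - y) ^ 2) := by
        rw [Real.exp_add]; ring
    _ ≤ (1 + 2 / b) * Real.exp (b / 2 + -(b / 4) * (x₀ - y) ^ 2) := by gcongr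
    _ = _ := by rw [Real.exp_add]; ring

theorem aux_deriv {b : ℝ} (hb : 0 < b) {ψ : ℝ → ℝ} (hm : Measurable ψ) {M : ℝ}
    (hM : ∀ y, |ψ y| ≤ M) (x₀ : ℝ) :
    ∃ D : ℝ, HasDerivAt (fun x => ∫ y, Real.exp (-b * (x - y) ^ 2) * ψ y) D x₀ ∧
      |D| ≤ 2 * M := by
  have hM0 : 0 ≤ M := (abs_nonneg _).trans (hM 0)
  have key := hasDerivAt_integral_of_dominated_loc_of_deriv_le (μ := volume) (𝕜 := ℝ)
    (F := fun x y => Real.exp (-b * (x - y) ^ 2) * ψ y)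
    (F' := fun x y => (Real.exp (-b * (x - y) ^ 2) * (-b * (2 * (x - y)))) * ψ y)
    (x₀ := x₀) (s := Metric.closedBall x₀ 1)
    (bound := fun y => 2 * b * M * ((1 + 2 / b) * Real.exp (b / 2) *
      Real.exp (-(b / 4) * (x₀ - y) ^ 2)))
    (Metric.closedBall_mem_nhds _ one_pos)
    (Filter.Eventually.of_forall fun x => by fun_prop)
    (by
      refine Integrable.mul_bdd (c := M) ?_ hm.aestronglyMeasurable
        (Filter.Eventually.of_forall hM)
      exact (integrable_exp_neg_mul_sq hb).comp_sub_left x₀)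
    (by fun_prop)
    (Filter.Eventually.of_forall fun y x hx => by
      have h1 := aux_bound hb x x₀ y (by simpa [Real.dist_eq] using hx)
      have h2 : ‖(Real.exp (-b * (x - y) ^ 2) * (-b * (2 * (x - y)))) * ψ y‖
          = 2 * b * |ψ y| * (|x - y| * Real.exp (-b * (x - y) ^ 2)) := by
        simp only [Real.norm_eq_abs, abs_mul, abs_neg, abs_of_pos hb, Real.abs_exp, abs_two]
        ring
      rw [h2]
      have := hM y
      gcongr)
    (by
      have := (integrable_exp_neg_mul_sq (b := b / 4) (by positivity)).comp_sub_left x₀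
      exact (this.const_mul _).const_mul _)
    (Filter.Eventually.of_forall fun y x hx => by
      have h1 : HasDerivAt (fun x : ℝ => -b * (x - y) ^ 2) (-b * (2 * (x - y))) x := by
        have := (((hasDerivAt_id x).sub_const y).pow 2).const_mul (-b)
        simpa using this
      exact h1.exp.mul_const _)
  refine ⟨_, key.2, ?_⟩
  have hi := ((aux_abs_integrable hb).comp_sub_left x₀).const_mul (2 * b * M)
  have h := norm_integral_le_of_norm_le hi (f := fun y =>
    (Real.exp (-b * (x₀ - y) ^ 2) * (-b * (2 * (x₀ - y)))) * ψ y)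
    (Filter.Eventually.of_forall fun y => by
      have h2 : ‖(Real.exp (-b * (x₀ - y) ^ 2) * (-b * (2 * (x₀ - y)))) * ψ y‖
          = 2 * b * |ψ y| * (|x₀ - y| * Real.exp (-b * (x₀ - y) ^ 2)) := by
        simp only [Real.norm_eq_abs, abs_mul, abs_neg, abs_of_pos hb, Real.abs_exp, abs_two]
        ring
      rw [h2]
      have := hM y
      gcongr)
  rw [integral_const_mul,
    integral_sub_left_eq_self (fun z : ℝ => |z| * Real.exp (-b * z ^ 2)) volume x₀,
    aux_abs_int hb] at h
  have e : 2 * b * M * (1 / b) = 2 * M := by field_simp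
  rw [e] at h
  exact h

theorem aux_split {b : ℝ} (hb : 0 < b) {φ : ℝ → ℝ} {M : ℝ}
    (hm : Measurable ((Ioi (0:ℝ)).indicator φ))
    (hM : ∀ y, |(Ioi (0:ℝ)).indicator φ y| ≤ M) (x : ℝ) :
    ∫ y in Ioi (0:ℝ), (Real.exp (-b * (x - y) ^ 2) - Real.exp (-b * (x + y) ^ 2)) * φ y
      = ∫ y, Real.exp (-b * (x - y) ^ 2) *
        ((Ioi (0:ℝ)).indicator φ y - (Ioi (0:ℝ)).indicator φ (-y)) := by
  set g := (Ioi (0:ℝ)).indicator φ with hg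
  have hE := (integrable_exp_neg_mul_sq hb).comp_sub_left x
  have i1 : Integrable (fun y => Real.exp (-b * (x - y) ^ 2) * g y) :=
    hE.mul_bdd (c := M) hm.aestronglyMeasurable (Filter.Eventually.of_forall hM)
  have i2 : Integrable (fun y => Real.exp (-b * (x - y) ^ 2) * g (-y)) :=
    hE.mul_bdd (c := M) (hm.comp measurable_neg).aestronglyMeasurable
      (Filter.Eventually.of_forall fun y => hM (-y))
  have i3 : Integrable (fun y => Real.exp (-b * (x + y) ^ 2) * g y) := by
    have := i2.comp_neg
    simpa using this
  have e3 : ∫ y, Real.exp (-b * (x - y) ^ 2) * g (-y)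
      = ∫ y, Real.exp (-b * (x + y) ^ 2) * g y := by
    rw [← integral_neg_eq_self]
    simp
  simp only [mul_sub]
  rw [integral_sub i1 i2, e3, ← integral_sub i1 i3, ← integral_indicator measurableSet_Ioi]
  congr 1
  ext y
  by_cases hy : y ∈ Ioi (0:ℝ)
  · simp [hg, indicator_of_mem hy]; ring
  · simp [hg, indicator_of_notMem hy]

/-- Lemma 3.1 (iii), first space-derivative estimate: for `t > 0`, `x ↦ (S(t)φ)(x)` is
differentiable on `(0,∞)` and `|∂_x (S(t)φ)(x)| ≤ e^{-μt} ‖φ‖ / √(πt)` for all `x > 0`. -/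
theorem stmt_6 (μ : ℝ) (hμ : 0 < μ) (φ : ℝ → ℝ)
    (hcont : ContinuousOn φ (Set.Ici 0))
    (hbdd : ∃ M, ∀ x ≥ (0:ℝ), |φ x| ≤ M) :
    ∀ t > (0:ℝ),
      (∀ x ∈ Set.Ioi (0:ℝ), DifferentiableAt ℝ (heatS μ t φ) x) ∧
      (∀ x > (0:ℝ), |deriv (heatS μ t φ) x| ≤
        Real.exp (-μ * t) * supnorm φ / Real.sqrt (Real.pi * t)) := by
  intro t ht
  obtain ⟨M₀, hM₀⟩ := hbdd
  have hbd : BddAbove (range fun x : Set.Ici (0:ℝ) => |φ (x : ℝ)|) :=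
    ⟨M₀, by rintro _ ⟨x, rfl⟩; exact hM₀ x x.2⟩
  have hsup : ∀ x ≥ (0:ℝ), |φ x| ≤ supnorm φ := fun x hx =>
    le_ciSup hbd (⟨x, hx⟩ : Set.Ici (0:ℝ))
  have hs0 : 0 ≤ supnorm φ := (abs_nonneg _).trans (hsup 0 le_rfl)
  have hm : Measurable ((Ioi (0:ℝ)).indicator φ) := by
    classical
    rw [← Set.piecewise_eq_indicator]
    exact (hcont.mono Ioi_subset_Ici_self).measurable_piecewise
      continuousOn_const measurableSet_Ioi
  have hM : ∀ y, |(Ioi (0:ℝ)).indicator φ y| ≤ supnorm φ := by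
    intro y
    by_cases hy : y ∈ Ioi (0:ℝ)
    · rw [indicator_of_mem hy]; exact hsup y (le_of_lt hy)
    · rw [indicator_of_notMem hy]; simpa using hs0
  have hM2 : ∀ y, |(Ioi (0:ℝ)).indicator φ y - (Ioi (0:ℝ)).indicator φ (-y)| ≤ supnorm φ := by
    intro y
    by_cases hy : y ∈ Ioi (0:ℝ)
    · have : -y ∉ Ioi (0:ℝ) := by simp only [mem_Ioi] at *; linarith
      rw [indicator_of_notMem this, sub_zero]; exact hM y
    · rw [indicator_of_notMem hy, zero_sub, abs_neg]; exact hM (-y)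
  have hb : 0 < 1 / (4 * t) := by positivity
  have hS : heatS μ t φ = fun x => (Real.exp (-μ * t) * (1 / Real.sqrt (4 * Real.pi * t))) *
      ∫ y, Real.exp (-(1 / (4 * t)) * (x - y) ^ 2) *
        ((Ioi (0:ℝ)).indicator φ y - (Ioi (0:ℝ)).indicator φ (-y)) := by
    ext x
    rw [← aux_split hb hm hM x, heatS, if_neg ht.ne', mul_assoc]
    congr 1
    rw [← integral_const_mul]
    congr 1
    ext y
    rw [heatG]
    have e : ∀ z : ℝ, -z ^ 2 / (4 * t) = -(1 / (4 * t)) * z ^ 2 := fun z => by ring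
    rw [e, e, mul_assoc]
  have hψ : Measurable fun y => (Ioi (0:ℝ)).indicator φ y - (Ioi (0:ℝ)).indicator φ (-y) :=
    hm.sub (hm.comp measurable_neg)
  have main : ∀ x, ∃ D, HasDerivAt (heatS μ t φ) D x ∧
      |D| ≤ Real.exp (-μ * t) * supnorm φ / Real.sqrt (Real.pi * t) := by
    intro x
    obtain ⟨D, hD, hDb⟩ := aux_deriv hb hψ hM2 x
    refine ⟨_, hS ▸ hD.const_mul _, ?_⟩
    have hsq : Real.sqrt (4 * Real.pi * t) = 2 * Real.sqrt (Real.pi * t) := by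
      rw [mul_assoc, Real.sqrt_mul (by norm_num), show (4:ℝ) = 2 ^ 2 by norm_num,
        Real.sqrt_sq (by norm_num)]
    have hp : 0 < Real.sqrt (Real.pi * t) := Real.sqrt_pos.2 (by positivity)
    have hc : 0 ≤ Real.exp (-μ * t) * (1 / Real.sqrt (4 * Real.pi * t)) := by positivity
    rw [abs_mul, abs_of_nonneg hc]
    calc _ ≤ Real.exp (-μ * t) * (1 / Real.sqrt (4 * Real.pi * t)) * (2 * supnorm φ) := by gcongr
      _ = _ := by rw [hsq]; field_simp
  refine ⟨fun x _ => ?_, fun x _ => ?_⟩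
  · obtain ⟨D, hD, _⟩ := main x
    exact hD.differentiableAt
  · obtain ⟨D, hD, h⟩ := main x
    rw [hD.deriv]; exact h
end

section
/- Let Ω be a nonempty set and θ: ℝ → (Ω → Ω) a flow, i.e. θ₀ = id and θ_{t+s} = θ_t ∘ θ_s for all t, s ∈ ℝ. Let (Y, d) be a complete metric space with bounded metric, and let Φ: [0,∞) × Ω × Y → Y satisfy: Φ(0, ω, ·) = id for all ω; the cocycle property Φ(t+s, ω, x) = Φ(t, θ_s ω, Φ(s, ω, x)) for all t, s ≥ 0, ω ∈ Ω, x ∈ Y; x ↦ Φ(t, ω, x) is continuous for each t ≥ 0 and ω ∈ Ω; and there exists a constant k < 0 such that d(Φ(1, ω, x), Φ(1, ω, y)) ≤ e^k·d(x, y) for all ω ∈ Ω and x, y ∈ Y. Then there exists a unique map γ*: Ω → Y such that Φ(t, ω, γ*(ω)) = γ*(θ_t ω) for all t ≥ 0 and ω ∈ Ω; moreover, for every ω ∈ Ω and every x ∈ Y, d(Φ(t, θ_{−t} ω, x), γ*(ω)) → 0 as t → ∞. -/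
open Filter

/-- Lemma 5.1 (generalized Banach fixed point theorem for cocycles): if `Φ` is a continuous
cocycle over the flow `θ` on a complete metric space `Y` with bounded metric, and `Φ(1, ω, ·)`
is a uniform contraction with rate `e^k`, `k < 0`, then `Φ` has a unique generalized fixed
point `γ*`, and `Φ(t, θ_{-t} ω, x) → γ*(ω)` as `t → ∞` for every `ω` and `x`. -/
theorem stmt_13 {Ω : Type*} [Nonempty Ω] {Y : Type*} [MetricSpace Y] [CompleteSpace Y]
    [Nonempty Y]
    (hbdd : ∃ C, ∀ x y : Y, dist x y ≤ C)
    (θ : ℝ → Ω → Ω) (hθ0 : θ 0 = id) (hθ : ∀ t s : ℝ, θ (t + s) = θ t ∘ θ s)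
    (Φ : ℝ → Ω → Y → Y)
    (hΦ0 : ∀ ω, Φ 0 ω = id)
    (hcocycle : ∀ t ≥ (0:ℝ), ∀ s ≥ (0:ℝ), ∀ ω x, Φ (t + s) ω x = Φ t (θ s ω) (Φ s ω x))
    (hcont : ∀ t ≥ (0:ℝ), ∀ ω, Continuous (Φ t ω))
    (k : ℝ) (hk : k < 0)
    (hcontr : ∀ ω, ∀ x y : Y, dist (Φ 1 ω x) (Φ 1 ω y) ≤ Real.exp k * dist x y) :
    ∃ γ : Ω → Y,
      (∀ t ≥ (0:ℝ), ∀ ω, Φ t ω (γ ω) = γ (θ t ω)) ∧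
      (∀ γ' : Ω → Y, (∀ t ≥ (0:ℝ), ∀ ω, Φ t ω (γ' ω) = γ' (θ t ω)) → γ' = γ) ∧
      (∀ ω, ∀ x : Y,
        Tendsto (fun t : ℝ => dist (Φ t (θ (-t) ω) x) (γ ω)) atTop (nhds 0)) := by
  obtain ⟨C, hC⟩ := hbdd
  have hθ' : ∀ t s ω, θ t (θ s ω) = θ (t + s) ω := fun t s ω => by rw [hθ]; rfl
  set r := Real.exp k with hr
  have hr0 : 0 ≤ r := (Real.exp_pos k).le
  have hr1 : r < 1 := by rw [hr, ← Real.exp_zero]; exact Real.exp_lt_exp.2 hk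
  have hn : ∀ (n : ℕ) ω x y, dist (Φ n ω x) (Φ n ω y) ≤ r ^ n * C := by
    intro n
    induction n with
    | zero => intro ω x y; simpa [hΦ0] using hC x y
    | succ n ih =>
      intro ω x y
      have e : ((n + 1 : ℕ) : ℝ) = 1 + (n : ℝ) := by push_cast; ring
      rw [e, hcocycle 1 zero_le_one n n.cast_nonneg, hcocycle 1 zero_le_one n n.cast_nonneg]
      calc _ ≤ r * dist (Φ n ω x) (Φ n ω y) := hcontr _ _ _
        _ ≤ r * (r ^ n * C) := mul_le_mul_of_nonneg_left (ih ω x y) hr0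
        _ = _ := by ring
  have key : ∀ (n : ℕ) (t : ℝ), (n : ℝ) ≤ t → ∀ ω x,
      Φ t (θ (-t) ω) x = Φ n (θ (-n) ω) (Φ (t - n) (θ (-t) ω) x) := by
    intro n t ht ω x
    have h := hcocycle n n.cast_nonneg (t - n) (sub_nonneg.2 ht) (θ (-t) ω) x
    rw [hθ', add_sub_cancel] at h
    rw [h]
    congr 2
    ring
  have hP : ∀ (n : ℕ) (t s : ℝ), (n : ℝ) ≤ t → (n : ℝ) ≤ s → ∀ ω x y,
      dist (Φ t (θ (-t) ω) x) (Φ s (θ (-s) ω) y) ≤ r ^ n * C := by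
    intro n t s ht hs ω x y
    rw [key n t ht, key n s hs]
    exact hn _ _ _ _
  have hlim : Tendsto (fun n : ℕ => r ^ n * C) atTop (nhds 0) := by
    simpa using (tendsto_pow_atTop_nhds_zero_of_lt_one hr0 hr1).mul_const C
  obtain ⟨x0⟩ := ‹Nonempty Y›
  have hex : ∀ ω, ∃ z, Tendsto (fun n : ℕ => Φ n (θ (-n) ω) x0) atTop (nhds z) := by
    intro ω
    apply cauchySeq_tendsto_of_complete
    refine cauchySeq_of_le_tendsto_0 (fun n : ℕ => r ^ n * C) ?_ hlim
    intro n m N h1 h2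
    exact hP N n m (by exact_mod_cast h1) (by exact_mod_cast h2) ω x0 x0
  choose γ hγ using hex
  have hd : ∀ (n : ℕ) (t : ℝ), (n : ℝ) ≤ t → ∀ ω x,
      dist (Φ t (θ (-t) ω) x) (γ ω) ≤ r ^ n * C := by
    intro n t ht ω x
    refine le_of_tendsto (tendsto_const_nhds.dist (hγ ω)) ?_
    filter_upwards [eventually_ge_atTop n] with m hm
    exact hP n t m ht (by exact_mod_cast hm) ω x x0
  have hT : ∀ ω, ∀ x : Y,
        Tendsto (fun t : ℝ => dist (Φ t (θ (-t) ω) x) (γ ω)) atTop (nhds 0) := by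
    intro ω x
    refine squeeze_zero' (Eventually.of_forall fun _ => dist_nonneg) ?_
      (hlim.comp (tendsto_nat_floor_atTop (α := ℝ)))
    filter_upwards [eventually_ge_atTop 0] with t ht
    exact hd _ t (Nat.floor_le ht) ω x
  refine ⟨γ, ?_, ?_, hT⟩
  · intro t ht ω
    have h1 := ((hcont t ht ω).tendsto (γ ω)).comp (hγ ω)
    have h2 := (tendsto_iff_dist_tendsto_zero.2 (hT (θ t ω) x0)).comp
      (tendsto_atTop_add_const_left atTop t tendsto_natCast_atTop_atTop)
    refine tendsto_nhds_unique h1 (h2.congr fun n => ?_)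
    simp only [Function.comp]
    rw [hθ', hcocycle t ht n n.cast_nonneg, hθ']
    have e1 : -(t + (n : ℝ)) + t = -n := by ring
    have e2 : (n : ℝ) + -n = 0 := by ring
    rw [e1, e2, hθ0]
    rfl
  · intro γ' h'
    funext ω
    refine dist_le_zero.1 (ge_of_tendsto' hlim fun n => ?_)
    have h := hd n n le_rfl ω (γ' (θ (-n) ω))
    rw [h' n n.cast_nonneg, hθ', add_neg_cancel, hθ0] at h
    exact h
end

section
/- Assume f: ℝ → ℝ is continuously differentiable with f(0) = 0 and |f′(s)| ≤ L_f for all s ∈ ℝ, where L_f > 0. Let ζ: [−τ,∞) → X be continuous and bounded, h: [0,∞) → X continuous and bounded, and let v^φ and v^ψ be mild solutions with the same noise path ζ and forcing h and with initial data φ ∈ C and ψ ∈ C respectively. Then for every t ≥ 0, ‖v^φ_t − v^ψ_t‖_C ≤ e^{μτ}·exp((ε L_f e^{μτ} − μ)·t)·‖φ − ψ‖_C. In particular, if ε L_f e^{μτ} < μ, any two mild solutions converge to each other exponentially fast in the supremum norm. -/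
open Set Real MeasureTheory intervalIntegral

/-- The nonlocal operator `(Kφ)(x) = ∫₀^∞ Γ(α,x,y) φ(y) dy`. -/
noncomputable def Kop (α : ℝ) (φ : ℝ → ℝ) (x : ℝ) : ℝ :=
  ∫ y in Set.Ioi (0:ℝ), heatG α x y * φ y

/-- The supremum norm `‖φ‖ = sup_{x ≥ 0} |φ x|` of the phase space `X`. -/
noncomputable def Xnorm (φ : ℝ → ℝ) : ℝ := ⨆ x : Set.Ici (0:ℝ), |φ (x : ℝ)|

/-- Membership in the phase space `X`: bounded, uniformly continuous on `[0,∞)`, vanishing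
at `0`. -/
def InX (φ : ℝ → ℝ) : Prop :=
  (∃ M, ∀ x ≥ (0:ℝ), |φ x| ≤ M) ∧ UniformContinuousOn φ (Set.Ici 0) ∧ φ 0 = 0

/-- Continuity of a curve `t ↦ v t` with respect to the supremum norm of `X`, on a set `s`. -/
def XContOn (v : ℝ → ℝ → ℝ) (s : Set ℝ) : Prop :=
  ∀ t ∈ s, ∀ ε > (0:ℝ), ∃ δ > (0:ℝ), ∀ t' ∈ s, |t' - t| < δ →
    Xnorm (fun x => v t' x - v t x) < ε

/-- Boundedness of a curve `t ↦ v t` in the supremum norm of `X`, on a set `s`. -/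
def XBddOn (v : ℝ → ℝ → ℝ) (s : Set ℝ) : Prop :=
  ∃ M, ∀ t ∈ s, Xnorm (v t) ≤ M

/-- A mild solution with delay `τ`, initial datum `ψ`, noise path `ζ` and forcing `h`:
a continuous `X`-valued curve `v` on `[-τ, ∞)` with `v = ψ` on `[-τ, 0]` satisfying
`v(t) = S(t)ψ(0) + ε ∫₀ᵗ S(t-r) K[f ∘ (v(r-τ) + ζ(r-τ))] dr + ∫₀ᵗ S(t-r) h(r) dr`. -/
def IsMildSolution (μ ε α τ : ℝ) (f : ℝ → ℝ) (ψ ζ h v : ℝ → ℝ → ℝ) : Prop :=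
  (∀ t ∈ Set.Ici (-τ), InX (v t)) ∧
  XContOn v (Set.Ici (-τ)) ∧
  (∀ t ∈ Set.Icc (-τ) (0:ℝ), ∀ x, v t x = ψ t x) ∧
  (∀ t ≥ (0:ℝ), ∀ x ≥ (0:ℝ),
    v t x = heatS μ t (ψ 0) x
      + ε * (∫ r in (0:ℝ)..t,
          heatS μ (t - r) (Kop α (fun y => f (v (r - τ) y + ζ (r - τ) y))) x)
      + ∫ r in (0:ℝ)..t, heatS μ (t - r) (h r) x)

lemma heatG_nonneg {t x y : ℝ} (ht : 0 < t) (hx : 0 ≤ x) (hy : 0 ≤ y) : 0 ≤ heatG t x y := by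
  unfold heatG
  apply mul_nonneg (by positivity)
  rw [sub_nonneg, Real.exp_le_exp]
  apply div_le_div_of_nonneg_right _ (by positivity)
  nlinarith [mul_nonneg hx hy]

lemma gauss_int {t : ℝ} (ht : 0 < t) (x : ℝ) :
    Integrable (fun y : ℝ => (1 / Real.sqrt (4 * Real.pi * t)) * Real.exp (-(x - y) ^ 2 / (4 * t)))
    ∧ ∫ y : ℝ, (1 / Real.sqrt (4 * Real.pi * t)) * Real.exp (-(x - y) ^ 2 / (4 * t)) = 1 := by
  have hb : 0 < 1 / (4 * t) := by positivity
  have e : ∀ y : ℝ, Real.exp (-(x - y) ^ 2 / (4 * t)) = Real.exp (-(1 / (4 * t)) * (y - x) ^ 2) := by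
    intro y; congr 1; ring
  simp_rw [e]
  constructor
  · exact ((integrable_exp_neg_mul_sq hb).comp_sub_right x).const_mul _
  · rw [MeasureTheory.integral_const_mul,
      integral_sub_right_eq_self (fun y : ℝ => Real.exp (-(1 / (4 * t)) * y ^ 2)) x,
      integral_gaussian]
    have : Real.pi / (1 / (4 * t)) = 4 * Real.pi * t := by field_simp
    rw [this]
    have : 0 < Real.sqrt (4 * Real.pi * t) := Real.sqrt_pos.2 (by positivity)
    field_simp

lemma heatG_meas : Measurable (fun p : ℝ × ℝ × ℝ => heatG p.1 p.2.1 p.2.2) := by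
  unfold heatG
  fun_prop

lemma heatG_integrable {t x : ℝ} (ht : 0 < t) (hx : 0 ≤ x) :
    IntegrableOn (heatG t x) (Ioi 0) := by
  refine Integrable.mono' (gauss_int ht x).1.integrableOn ?_ ?_
  · exact (heatG_meas.comp (measurable_const.prodMk (measurable_const.prodMk measurable_id))).aestronglyMeasurable
  · refine (ae_restrict_mem measurableSet_Ioi).mono fun y hy => ?_
    rw [Real.norm_of_nonneg (heatG_nonneg ht hx (le_of_lt hy))]
    unfold heatG
    apply mul_le_mul_of_nonneg_left _ (by positivity)
    linarith [Real.exp_pos (-(x + y) ^ 2 / (4 * t))]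

lemma heatG_integral_le {t x : ℝ} (ht : 0 < t) (hx : 0 ≤ x) :
    ∫ y in Ioi (0:ℝ), heatG t x y ≤ 1 := by
  rw [← (gauss_int ht x).2]
  refine le_trans (integral_mono_ae (heatG_integrable ht hx) (gauss_int ht x).1.integrableOn ?_)
    (setIntegral_le_integral (gauss_int ht x).1 (ae_of_all _ fun y => by positivity))
  refine ae_of_all _ fun y => ?_
  show heatG t x y ≤ _
  unfold heatG
  apply mul_le_mul_of_nonneg_left _ (by positivity)
  linarith [Real.exp_pos (-(x + y) ^ 2 / (4 * t))]

lemma heatG_mul_integrable {t x M : ℝ} (ht : 0 < t) (hx : 0 ≤ x) {φ : ℝ → ℝ}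
    (hm : Measurable φ) (hb : ∀ y ≥ (0:ℝ), |φ y| ≤ M) :
    IntegrableOn (fun y => heatG t x y * φ y) (Ioi 0) := by
  refine Integrable.mul_bdd (c := M) (heatG_integrable ht hx) hm.aestronglyMeasurable ?_
  exact (ae_restrict_mem measurableSet_Ioi).mono fun y hy => hb y (le_of_lt hy)

lemma heatG_bound {t x B : ℝ} (ht : 0 < t) (hx : 0 ≤ x) (hB : 0 ≤ B) {φ : ℝ → ℝ}
    (hb : ∀ y ≥ (0:ℝ), |φ y| ≤ B) :
    |∫ y in Ioi (0:ℝ), heatG t x y * φ y| ≤ B := by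
  have := norm_integral_le_of_norm_le (μ := volume.restrict (Ioi (0:ℝ)))
    (f := fun y => heatG t x y * φ y) (g := fun y => heatG t x y * B)
    ((heatG_integrable ht hx).mul_const B)
    ((ae_restrict_mem measurableSet_Ioi).mono fun y hy => by
      have h0 := heatG_nonneg ht hx (le_of_lt hy)
      rw [Real.norm_eq_abs, abs_mul, abs_of_nonneg h0]
      exact mul_le_mul_of_nonneg_left (hb y (le_of_lt hy)) h0)
  rw [MeasureTheory.integral_mul_const] at this
  have h1 := heatG_integral_le ht hx
  rw [Real.norm_eq_abs] at this
  nlinarith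

lemma heatS_bound {μ t x B : ℝ} (ht : 0 ≤ t) (hx : 0 ≤ x) (hB : 0 ≤ B) {φ : ℝ → ℝ}
    (hb : ∀ y ≥ (0:ℝ), |φ y| ≤ B) : |heatS μ t φ x| ≤ Real.exp (-μ * t) * B := by
  unfold heatS
  split_ifs with h
  · subst h; simpa using hb x hx
  · rw [abs_mul, abs_of_pos (Real.exp_pos _)]
    exact mul_le_mul_of_nonneg_left
      (heatG_bound (lt_of_le_of_ne ht (Ne.symm h)) hx hB hb) (Real.exp_pos _).le

lemma heatS_sub {μ t x M : ℝ} (ht : 0 ≤ t) (hx : 0 ≤ x) {φ ψ : ℝ → ℝ}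
    (hm : Measurable φ) (hb : ∀ y ≥ (0:ℝ), |φ y| ≤ M)
    (hm' : Measurable ψ) (hb' : ∀ y ≥ (0:ℝ), |ψ y| ≤ M) :
    heatS μ t φ x - heatS μ t ψ x = heatS μ t (fun y => φ y - ψ y) x := by
  unfold heatS
  split_ifs with h
  · rfl
  · have h0 := lt_of_le_of_ne ht (Ne.symm h)
    rw [← mul_sub, ← MeasureTheory.integral_sub (heatG_mul_integrable h0 hx hm hb)
      (heatG_mul_integrable h0 hx hm' hb')]
    simp_rw [mul_sub]

lemma heatS_congr {μ t x : ℝ} (hx : 0 ≤ x) {φ ψ : ℝ → ℝ} (h : ∀ y ≥ (0:ℝ), φ y = ψ y) :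
    heatS μ t φ x = heatS μ t ψ x := by
  unfold heatS
  split_ifs
  · exact h x hx
  · congr 1
    refine setIntegral_congr_fun measurableSet_Ioi fun y hy => ?_
    simp only [h y (le_of_lt hy)]

lemma Kop_congr {α : ℝ} {φ ψ : ℝ → ℝ} (h : ∀ y ≥ (0:ℝ), φ y = ψ y) :
    Kop α φ = Kop α ψ := by
  funext x
  unfold Kop
  refine setIntegral_congr_fun measurableSet_Ioi fun y hy => ?_
  simp only [h y (le_of_lt hy)]

lemma Kop_meas {α : ℝ} {H : ℝ → ℝ → ℝ} (hH : Measurable (Function.uncurry H)) :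
    Measurable (Function.uncurry fun r z => Kop α (H r) z) := by
  have : StronglyMeasurable (fun p : ℝ × ℝ => ∫ y in Ioi (0:ℝ), heatG α p.2 y * H p.1 y) := by
    apply StronglyMeasurable.integral_prod_right'
      (f := fun q : (ℝ × ℝ) × ℝ => heatG α q.1.2 q.2 * H q.1.1 q.2)
    apply Measurable.stronglyMeasurable
    apply Measurable.mul
    · exact heatG_meas.comp (measurable_const.prodMk (measurable_fst.snd.prodMk measurable_snd))
    · exact hH.comp (measurable_fst.fst.prodMk measurable_snd)
  exact this.measurable

lemma heatS_meas {μ t x : ℝ} {H : ℝ → ℝ → ℝ} (hH : Measurable (Function.uncurry H)) :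
    Measurable (fun r => heatS μ (t - r) (H r) x) := by
  unfold heatS
  apply Measurable.ite
  · exact measurableSet_eq_fun (by fun_prop) (by fun_prop)
  · exact hH.comp (measurable_id.prodMk measurable_const)
  · apply Measurable.mul (by fun_prop)
    have : StronglyMeasurable (fun p : ℝ => ∫ y in Ioi (0:ℝ), heatG (t - p) x y * H p y) := by
      apply StronglyMeasurable.integral_prod_right'
        (f := fun q : ℝ × ℝ => heatG (t - q.1) x q.2 * H q.1 q.2)
      apply Measurable.stronglyMeasurable
      apply Measurable.mul
      · exact heatG_meas.comp ((measurable_const.sub measurable_fst).prodMk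
          (measurable_const.prodMk measurable_snd))
      · exact hH
    exact this.measurable

lemma duhamel_integrable {μ α t x M : ℝ} (hμ : 0 < μ) (hα : 0 < α) (ht : 0 ≤ t) (hx : 0 ≤ x)
    (hM : 0 ≤ M) {H : ℝ → ℝ → ℝ} (hH : Measurable (Function.uncurry H))
    (hb : ∀ r y, |H r y| ≤ M) :
    IntervalIntegrable (fun r => heatS μ (t - r) (Kop α (H r)) x) volume 0 t := by
  rw [intervalIntegrable_iff_integrableOn_Ioc_of_le ht]
  refine Measure.integrableOn_of_bounded (M := M) (by simp) ?_ ?_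
  · exact (heatS_meas (Kop_meas hH)).aestronglyMeasurable
  · refine (ae_restrict_mem measurableSet_Ioc).mono fun r hr => ?_
    have := heatS_bound (μ := μ) (t := t - r) (x := x) (by linarith [hr.2]) hx hM
      (φ := Kop α (H r)) (fun y hy => heatG_bound hα hy hM (fun z _ => hb r z))
    refine this.trans ?_
    have : Real.exp (-μ * (t - r)) ≤ 1 := by
      rw [Real.exp_le_one_iff]; nlinarith [hr.2]
    nlinarith

lemma duhamel_diff {μ α t x M : ℝ} (hμ : 0 < μ) (hα : 0 < α) (ht : 0 ≤ t) (hx : 0 ≤ x)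
    (hM : 0 ≤ M) {H H' : ℝ → ℝ → ℝ} (hH : Measurable (Function.uncurry H))
    (hb : ∀ r y, |H r y| ≤ M) (hH' : Measurable (Function.uncurry H'))
    (hb' : ∀ r y, |H' r y| ≤ M) {b : ℝ → ℝ} (hbc : Continuous b) (hb0 : ∀ r, 0 ≤ b r)
    (hd : ∀ r ∈ Icc 0 t, ∀ y ≥ (0:ℝ), |H r y - H' r y| ≤ b r) :
    |(∫ r in (0:ℝ)..t, heatS μ (t - r) (Kop α (H r)) x) -
      ∫ r in (0:ℝ)..t, heatS μ (t - r) (Kop α (H' r)) x| ≤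
      ∫ r in (0:ℝ)..t, Real.exp (-μ * (t - r)) * b r := by
  rw [← intervalIntegral.integral_sub (duhamel_integrable hμ hα ht hx hM hH hb)
    (duhamel_integrable hμ hα ht hx hM hH' hb')]
  rw [← Real.norm_eq_abs]
  refine intervalIntegral.norm_integral_le_of_norm_le ht ?_
    (Continuous.intervalIntegrable (by fun_prop) _ _)
  refine ae_of_all _ fun r hr => ?_
  have hmr : Measurable (H r) := hH.of_uncurry_left
  have hmr' : Measurable (H' r) := hH'.of_uncurry_left
  have hK : Measurable (Kop α (H r)) :=
    (Kop_meas (α := α) hH).of_uncurry_left (x := r)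
  have hK' : Measurable (Kop α (H' r)) :=
    (Kop_meas (α := α) hH').of_uncurry_left (x := r)
  have htr : 0 ≤ t - r := by linarith [hr.2]
  have kb : ∀ y ≥ (0:ℝ), |Kop α (H r) y| ≤ M :=
    fun y hy => heatG_bound hα hy hM (fun z _ => hb r z)
  have kb' : ∀ y ≥ (0:ℝ), |Kop α (H' r) y| ≤ M :=
    fun y hy => heatG_bound hα hy hM (fun z _ => hb' r z)
  have hfin : ∀ y ≥ (0:ℝ), |Kop α (H r) y - Kop α (H' r) y| ≤ b r := by
    intro y hy
    unfold Kop
    rw [← MeasureTheory.integral_sub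
      (heatG_mul_integrable hα hy hmr fun z _ => hb r z)
      (heatG_mul_integrable hα hy hmr' fun z _ => hb' r z)]
    simp_rw [← mul_sub]
    exact heatG_bound hα hy (hb0 r) (hd r ⟨hr.1.le, hr.2⟩)
  rw [heatS_sub htr hx hK kb hK' kb']
  exact heatS_bound htr hx (hb0 r) hfin

lemma Xnorm_nonneg (φ : ℝ → ℝ) : 0 ≤ Xnorm φ := Real.iSup_nonneg fun _ => abs_nonneg _

lemma Xnorm_le {φ : ℝ → ℝ} {B : ℝ} (h : ∀ x ≥ (0:ℝ), |φ x| ≤ B) : Xnorm φ ≤ B :=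
  haveI : Nonempty (Ici (0:ℝ)) := ⟨⟨0, self_mem_Ici⟩⟩
  ciSup_le fun x => h x x.2

lemma le_Xnorm {φ : ℝ → ℝ} {B : ℝ} (h : ∀ x ≥ (0:ℝ), |φ x| ≤ B) {x : ℝ} (hx : 0 ≤ x) :
    |φ x| ≤ Xnorm φ :=
  le_ciSup (f := fun x : Ici (0:ℝ) => |φ x|) ⟨B, by rintro _ ⟨y, rfl⟩; exact h y y.2⟩ ⟨x, hx⟩

lemma le_Xnorm_sub {φ ψ : ℝ → ℝ} (h1 : InX φ) (h2 : InX ψ) {x : ℝ} (hx : 0 ≤ x) :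
    |φ x - ψ x| ≤ Xnorm (fun x => φ x - ψ x) := by
  obtain ⟨⟨A, hA⟩, -⟩ := h1
  obtain ⟨⟨B, hB⟩, -⟩ := h2
  exact le_Xnorm (φ := fun x => φ x - ψ x) (B := A + B)
    (fun y hy => (abs_sub _ _).trans (add_le_add (hA y hy) (hB y hy))) hx

lemma curve_bdd {v : ℝ → ℝ → ℝ} {s : Set ℝ} (hs : IsCompact s) (hX : ∀ t ∈ s, InX (v t))
    (hc : XContOn v s) : ∃ M, 0 ≤ M ∧ ∀ t ∈ s, ∀ x ≥ (0:ℝ), |v t x| ≤ M := by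
  have hcont : ContinuousOn (fun t => Xnorm (v t)) s := by
    rw [Metric.continuousOn_iff]
    intro t ht e he
    obtain ⟨δ, hδ, h⟩ := hc t ht e he
    refine ⟨δ, hδ, fun t' ht' hd => ?_⟩
    have h1 := h t' ht' hd
    refine lt_of_le_of_lt ?_ h1
    rw [Real.dist_eq, abs_le]
    obtain ⟨A, hA⟩ := (hX t ht).1
    obtain ⟨B, hB⟩ := (hX t' ht').1
    have k1 : Xnorm (v t) ≤ Xnorm (v t') + Xnorm (fun x => v t' x - v t x) :=
      Xnorm_le fun x hx => by
        have a := le_Xnorm_sub (hX t' ht') (hX t ht) hx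
        have b := le_Xnorm hB hx
        rw [abs_le] at *
        constructor <;> linarith [a.1, a.2, b.1, b.2]
    have k2 : Xnorm (v t') ≤ Xnorm (v t) + Xnorm (fun x => v t' x - v t x) :=
      Xnorm_le fun x hx => by
        have a := le_Xnorm_sub (hX t' ht') (hX t ht) hx
        have b := le_Xnorm hA hx
        rw [abs_le] at *
        constructor <;> linarith [a.1, a.2, b.1, b.2]
    constructor <;> linarith
  obtain ⟨M, hM⟩ := hs.exists_bound_of_continuousOn hcont
  refine ⟨max M 0, le_max_right _ _, fun t ht x hx => ?_⟩
  obtain ⟨A, hA⟩ := (hX t ht).1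
  exact (le_Xnorm hA hx).trans ((le_abs_self _).trans ((hM t ht).trans (le_max_left _ _)))

lemma curve_cont {v : ℝ → ℝ → ℝ} {s : Set ℝ} (hX : ∀ t ∈ s, InX (v t))
    (hc : XContOn v s) : ContinuousOn (fun p : ℝ × ℝ => v p.1 p.2) (s ×ˢ Ici 0) := by
  rw [Metric.continuousOn_iff]
  rintro ⟨t, x⟩ ⟨ht, hx⟩ e he
  obtain ⟨δ, hδ, h⟩ := hc t ht (e / 2) (by linarith)
  obtain ⟨η, hη, h'⟩ := Metric.continuousOn_iff.1 (hX t ht).2.1.continuousOn x hx (e / 2) (by linarith)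
  refine ⟨min δ η, lt_min hδ hη, ?_⟩
  rintro ⟨t', x'⟩ ⟨ht', hx'⟩ hd
  rw [Prod.dist_eq, max_lt_iff] at hd
  have a := h t' ht' (lt_of_lt_of_le hd.1 (min_le_left _ _))
  have b := h' x' hx' (lt_of_lt_of_le hd.2 (min_le_right _ _))
  have c := le_Xnorm_sub (hX t' ht') (hX t ht) hx'
  rw [Real.dist_eq] at *
  have := abs_sub_le (v t' x') (v t x') (v t x)
  simp only at *
  linarith

lemma f_lip {f : ℝ → ℝ} {Lf : ℝ} (hf : ContDiff ℝ 1 f) (hf' : ∀ s, |deriv f s| ≤ Lf) (a b : ℝ) :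
    |f a - f b| ≤ Lf * |a - b| :=
  Convex.norm_image_sub_le_of_norm_deriv_le (s := univ)
    (fun x _ => (hf.differentiable (by norm_num)) x) (fun x _ => hf' x) convex_univ
    (mem_univ b) (mem_univ a)

/-- truncated nonlinearity -/
noncomputable def FH (f : ℝ → ℝ) (τ t : ℝ) (v ζ : ℝ → ℝ → ℝ) (r y : ℝ) : ℝ :=
  (Icc 0 t ×ˢ Ici (0:ℝ)).indicator (fun p : ℝ × ℝ => f (v (p.1 - τ) p.2 + ζ (p.1 - τ) p.2)) (r, y)

lemma FH_eq (f : ℝ → ℝ) (τ t : ℝ) (v ζ : ℝ → ℝ → ℝ) {r y : ℝ} (hr : r ∈ Icc 0 t) (hy : 0 ≤ y) :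
    FH f τ t v ζ r y = f (v (r - τ) y + ζ (r - τ) y) :=
  indicator_of_mem (show (r, y) ∈ Icc 0 t ×ˢ Ici (0:ℝ) from ⟨hr, hy⟩) _

lemma FH_meas {f : ℝ → ℝ} {τ : ℝ} (t : ℝ) {v ζ : ℝ → ℝ → ℝ} (hf : Continuous f)
    (hv : ∀ t ∈ Ici (-τ), InX (v t)) (hvc : XContOn v (Ici (-τ)))
    (hζ : ∀ t ∈ Ici (-τ), InX (ζ t)) (hζc : XContOn ζ (Ici (-τ))) :
    Measurable (Function.uncurry (FH f τ t v ζ)) := by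
  have hS : MeasurableSet (Icc 0 t ×ˢ Ici (0:ℝ)) := measurableSet_Icc.prod measurableSet_Ici
  have hmap : MapsTo (fun p : ℝ × ℝ => (p.1 - τ, p.2)) (Icc 0 t ×ˢ Ici (0:ℝ))
      (Ici (-τ) ×ˢ Ici (0:ℝ)) := by
    rintro ⟨r, y⟩ ⟨hr, hy⟩
    refine ⟨?_, hy⟩
    have := hr.1
    simp only [mem_Ici] at *
    linarith
  have h1 := (curve_cont hv hvc).comp (f := fun p : ℝ × ℝ => (p.1 - τ, p.2))
    (by fun_prop) hmap
  have h2 := (curve_cont hζ hζc).comp (f := fun p : ℝ × ℝ => (p.1 - τ, p.2))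
    (by fun_prop) hmap
  have h3 : ContinuousOn (fun p : ℝ × ℝ => f (v (p.1 - τ) p.2 + ζ (p.1 - τ) p.2))
      (Icc 0 t ×ˢ Ici (0:ℝ)) := hf.comp_continuousOn (h1.add h2)
  have h4 := h3.measurable_piecewise (g := 0) continuous_zero.continuousOn hS
  rw [piecewise_eq_indicator] at h4
  exact h4

lemma XContOn.mono {v : ℝ → ℝ → ℝ} {s u : Set ℝ} (h : XContOn v s) (hu : u ⊆ s) : XContOn v u := by
  intro t ht e he
  obtain ⟨δ, hδ, k⟩ := h t (hu ht) e he
  exact ⟨δ, hδ, fun t' ht' => k t' (hu ht')⟩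

lemma FH_bdd {f : ℝ → ℝ} {τ Lf : ℝ} (t : ℝ) {v ζ : ℝ → ℝ → ℝ} (hf0 : f 0 = 0)
    (hLf : 0 < Lf) (hlip : ∀ a b, |f a - f b| ≤ Lf * |a - b|)
    (hv : ∀ t ∈ Ici (-τ), InX (v t)) (hvc : XContOn v (Ici (-τ)))
    (hζ : ∀ t ∈ Ici (-τ), InX (ζ t)) (hζc : XContOn ζ (Ici (-τ))) :
    ∃ M, 0 ≤ M ∧ ∀ r y, |FH f τ t v ζ r y| ≤ M := by
  have hsub : Icc (-τ) (t - τ) ⊆ Ici (-τ) := Icc_subset_Ici_self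
  obtain ⟨A, hA0, hA⟩ := curve_bdd (isCompact_Icc (a := -τ) (b := t - τ))
    (fun s hs => hv s (hsub hs)) (hvc.mono hsub)
  obtain ⟨B, hB0, hB⟩ := curve_bdd (isCompact_Icc (a := -τ) (b := t - τ))
    (fun s hs => hζ s (hsub hs)) (hζc.mono hsub)
  refine ⟨Lf * (A + B), by positivity, fun r y => ?_⟩
  by_cases hp : (r, y) ∈ Icc 0 t ×ˢ Ici (0:ℝ)
  · rw [FH_eq _ _ _ _ _ hp.1 hp.2]
    have hr : r - τ ∈ Icc (-τ) (t - τ) := by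
      have := hp.1
      simp only [mem_Icc] at *
      constructor <;> linarith [this.1, this.2]
    have h1 := hlip (v (r - τ) y + ζ (r - τ) y) 0
    rw [hf0, sub_zero, sub_zero] at h1
    refine h1.trans (mul_le_mul_of_nonneg_left ?_ hLf.le)
    exact (abs_add_le _ _).trans (add_le_add (hA _ hr _ hp.2) (hB _ hr _ hp.2))
  · unfold FH
    rw [indicator_of_notMem hp, abs_zero]
    positivity

lemma exp_int {c : ℝ} (hc : c ≠ 0) (t : ℝ) :
    c * ∫ r in (0:ℝ)..t, Real.exp (c * r) = Real.exp (c * t) - 1 := by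
  rw [← intervalIntegral.integral_const_mul]
  have : ∀ r ∈ uIcc 0 t, HasDerivAt (fun r => Real.exp (c * r)) (c * Real.exp (c * r)) r := by
    intro r _
    have := ((hasDerivAt_id r).const_mul c).exp
    simpa [mul_comm] using this
  rw [intervalIntegral.integral_eq_sub_of_hasDerivAt this
    (Continuous.intervalIntegrable (by fun_prop) _ _)]
  simp

/-- Continuous dependence on the initial datum: if `f` is `C¹` with `f 0 = 0` and
`|f'| ≤ L_f`, then any two mild solutions `v^φ`, `v^ψ` with the same noise and forcing
satisfy `‖v^φ_t - v^ψ_t‖_C ≤ e^{μτ} exp((ε L_f e^{μτ} - μ) t) ‖φ - ψ‖_C` for all `t ≥ 0`,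
where `v_t(θ) = v(t+θ)` and `‖·‖_C` is the supremum over `θ ∈ [-τ,0]` of the `X`-norm. -/
theorem stmt_17 (μ ε α τ Lf : ℝ) (hμ : 0 < μ) (hε : 0 < ε) (hα : 0 < α) (hτ : 0 < τ)
    (hLf : 0 < Lf)
    (f : ℝ → ℝ) (hf : ContDiff ℝ 1 f) (hf0 : f 0 = 0) (hf' : ∀ s, |deriv f s| ≤ Lf)
    (ζ : ℝ → ℝ → ℝ) (hζX : ∀ t ∈ Set.Ici (-τ), InX (ζ t))
    (hζc : XContOn ζ (Set.Ici (-τ))) (hζb : XBddOn ζ (Set.Ici (-τ)))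
    (h : ℝ → ℝ → ℝ) (hhX : ∀ t ∈ Set.Ici (0:ℝ), InX (h t))
    (hhc : XContOn h (Set.Ici 0)) (hhb : XBddOn h (Set.Ici 0))
    (φ ψ : ℝ → ℝ → ℝ)
    (hφX : ∀ t ∈ Set.Icc (-τ) (0:ℝ), InX (φ t)) (hφc : XContOn φ (Set.Icc (-τ) 0))
    (hψX : ∀ t ∈ Set.Icc (-τ) (0:ℝ), InX (ψ t)) (hψc : XContOn ψ (Set.Icc (-τ) 0))
    (vφ vψ : ℝ → ℝ → ℝ)
    (hvφ : IsMildSolution μ ε α τ f φ ζ h vφ)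
    (hvψ : IsMildSolution μ ε α τ f ψ ζ h vψ) :
    ∀ t ≥ (0:ℝ),
      (⨆ θ : Set.Icc (-τ) (0:ℝ), Xnorm (fun x => vφ (t + θ) x - vψ (t + θ) x)) ≤
        Real.exp (μ * τ) * Real.exp ((ε * Lf * Real.exp (μ * τ) - μ) * t) *
          ⨆ θ : Set.Icc (-τ) (0:ℝ), Xnorm (fun x => φ θ x - ψ θ x) := by
  obtain ⟨h1X, h1c, h1i, h1⟩ := hvφ
  obtain ⟨h2X, h2c, h2i, h2⟩ := hvψ
  have hlip := f_lip hf hf'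
  haveI : Nonempty (Icc (-τ) (0:ℝ)) := ⟨⟨0, by simp [hτ.le]⟩⟩
  obtain ⟨A, hA0, hA⟩ := curve_bdd isCompact_Icc hφX hφc
  obtain ⟨B, hB0, hB⟩ := curve_bdd isCompact_Icc hψX hψc
  set D := ⨆ θ : Set.Icc (-τ) (0:ℝ), Xnorm (fun x => φ θ x - ψ θ x) with hD
  have hbd : ∀ s ∈ Icc (-τ) (0:ℝ), Xnorm (fun x => φ s x - ψ s x) ≤ D := by
    intro s hs
    refine le_ciSup (f := fun θ : Icc (-τ) (0:ℝ) => Xnorm (fun x => φ θ x - ψ θ x))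
      ⟨A + B, ?_⟩ ⟨s, hs⟩
    rintro _ ⟨θ, rfl⟩
    exact Xnorm_le fun x hx =>
      (abs_sub _ _).trans (add_le_add (hA θ θ.2 x hx) (hB θ θ.2 x hx))
  have hD0 : 0 ≤ D := Real.iSup_nonneg fun _ => Xnorm_nonneg _
  set c := ε * Lf * Real.exp (μ * τ) with hc
  have hc0 : 0 < c := by positivity
  have hini : ∀ s ∈ Icc (-τ) (0:ℝ), ∀ x ≥ (0:ℝ), |φ s x - ψ s x| ≤ D := fun s hs x hx =>
    (le_Xnorm_sub (hφX s hs) (hψX s hs) hx).trans (hbd s hs)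
  have h00 : (0:ℝ) ∈ Icc (-τ) (0:ℝ) := by simp [hτ.le]
  -- main estimate by the method of steps
  have key : ∀ n : ℕ, ∀ s, -τ ≤ s → s ≤ n * τ → ∀ x ≥ (0:ℝ),
      |vφ s x - vψ s x| ≤ D * Real.exp (-μ * s) * Real.exp (c * max s 0) := by
    intro n
    induction n with
    | zero =>
      intro s hs1 hs2 x hx
      have hs : s ∈ Icc (-τ) (0:ℝ) := ⟨hs1, by simpa using hs2⟩
      rw [h1i s hs, h2i s hs, max_eq_right hs.2]
      have : 1 ≤ Real.exp (-μ * s) := Real.one_le_exp (by nlinarith [hs.2])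
      have := hini s hs x hx
      simp only [mul_zero, Real.exp_zero, mul_one]
      nlinarith
    | succ n ih =>
      intro t ht1 ht2 x hx
      rcases le_or_gt t 0 with ht | ht
      · refine ih t ht1 (ht.trans (by positivity)) x hx
      rw [h1 t ht.le x hx, h2 t ht.le x hx, max_eq_left ht.le]
      obtain ⟨M1, hM10, hM1⟩ := FH_bdd t hf0 hLf hlip h1X h1c hζX hζc
      obtain ⟨M2, hM20, hM2⟩ := FH_bdd t hf0 hLf hlip h2X h2c hζX hζc
      have m1 := FH_meas t hf.continuous h1X h1c hζX hζc
      have m2 := FH_meas t hf.continuous h2X h2c hζX hζc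
      have conv : ∀ v : ℝ → ℝ → ℝ, (∫ r in (0:ℝ)..t,
          heatS μ (t - r) (Kop α (fun y => f (v (r - τ) y + ζ (r - τ) y))) x) =
          ∫ r in (0:ℝ)..t, heatS μ (t - r) (Kop α (FH f τ t v ζ r)) x := by
        intro v
        refine intervalIntegral.integral_congr fun r hr => ?_
        rw [uIcc_of_le ht.le] at hr
        rw [Kop_congr (fun y hy => (FH_eq f τ t v ζ hr hy).symm)]
      rw [conv vφ, conv vψ]
      have hdiff := duhamel_diff (b := fun r => Lf * (D * Real.exp (-μ * (r - τ)) * Real.exp (c * r)))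
        hμ hα ht.le hx (hM10.trans (le_max_left M1 M2)) m1
        (fun r y => (hM1 r y).trans (le_max_left _ _)) m2
        (fun r y => (hM2 r y).trans (le_max_right _ _)) (by fun_prop) (fun r => by positivity)
        (by
          intro r hr y hy
          rw [FH_eq _ _ _ _ _ hr hy, FH_eq _ _ _ _ _ hr hy]
          refine (hlip _ _).trans (mul_le_mul_of_nonneg_left ?_ hLf.le)
          rw [add_sub_add_right_eq_sub]
          refine (ih (r - τ) (by linarith [hr.1]) ?_ y hy).trans ?_
          · push_cast at ht2
            linarith [hr.2]
          · apply mul_le_mul_of_nonneg_left _ (by positivity)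
            rw [Real.exp_le_exp]
            apply mul_le_mul_of_nonneg_left _ hc0.le
            exact max_le (by linarith) hr.1)
      have hint : ε * (∫ r in (0:ℝ)..t, Real.exp (-μ * (t - r)) *
          (Lf * (D * Real.exp (-μ * (r - τ)) * Real.exp (c * r)))) =
          D * Real.exp (-μ * t) * (Real.exp (c * t) - 1) := by
        rw [← exp_int hc0.ne' t]
        have : ∀ r, Real.exp (-μ * (t - r)) *
          (Lf * (D * Real.exp (-μ * (r - τ)) * Real.exp (c * r))) =
          (Lf * D * Real.exp (-μ * t) * Real.exp (μ * τ)) * Real.exp (c * r) := by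
          intro r
          have e : Real.exp (-μ * (t - r)) * Real.exp (-μ * (r - τ)) =
            Real.exp (-μ * t) * Real.exp (μ * τ) := by
            rw [← Real.exp_add, ← Real.exp_add]; congr 1; ring
          linear_combination (Lf * D * Real.exp (c * r)) * e
        simp_rw [this]
        rw [intervalIntegral.integral_const_mul, hc]
        ring
      have hS : |heatS μ t (φ 0) x - heatS μ t (ψ 0) x| ≤ Real.exp (-μ * t) * D := by
        have mk : ∀ u : ℝ → ℝ, InX u → Measurable ((Ici (0:ℝ)).indicator u) := by
          intro u hu
          have := hu.2.1.continuousOn.measurable_piecewise (g := 0)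
            continuous_zero.continuousOn measurableSet_Ici
          rwa [piecewise_eq_indicator] at this
        have ei : ∀ u : ℝ → ℝ, ∀ y ≥ (0:ℝ), (Ici (0:ℝ)).indicator u y = u y :=
          fun u y hy => indicator_of_mem (show y ∈ Ici (0:ℝ) from hy) u
        rw [heatS_congr hx (fun y hy => (ei (φ 0) y hy).symm),
          heatS_congr hx (fun y hy => (ei (ψ 0) y hy).symm),
          heatS_sub (M := max A B) ht.le hx (mk _ (hφX 0 h00))
            (fun y hy => by rw [ei _ y hy]; exact (hA 0 h00 y hy).trans (le_max_left _ _))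
            (mk _ (hψX 0 h00))
            (fun y hy => by rw [ei _ y hy]; exact (hB 0 h00 y hy).trans (le_max_right _ _))]
        refine heatS_bound ht.le hx hD0 fun y hy => ?_
        rw [ei _ y hy, ei _ y hy]
        exact hini 0 h00 y hy
      have hdiff' := mul_le_mul_of_nonneg_left hdiff hε.le
      rw [hint] at hdiff'
      nth_rewrite 1 [← abs_of_pos hε] at hdiff'
      rw [← abs_mul] at hdiff'
      rw [abs_le] at hdiff' hS ⊢
      constructor <;> linarith [hdiff'.1, hdiff'.2, hS.1, hS.2]
  intro t ht
  refine ciSup_le fun θ => Xnorm_le fun x hx => ?_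
  have hθ1 := θ.2.1
  have hθ2 := θ.2.2
  obtain ⟨n, hn⟩ := exists_nat_ge ((t + θ) / τ)
  rw [div_le_iff₀ hτ] at hn
  refine (key n (t + θ) (by linarith) hn x hx).trans ?_
  rw [mul_assoc, mul_comm D, ← Real.exp_add, ← Real.exp_add]
  apply mul_le_mul_of_nonneg_right _ hD0
  rw [Real.exp_le_exp]
  have : c * max (t + θ) 0 ≤ c * t :=
    mul_le_mul_of_nonneg_left (max_le (by linarith) ht) hc0.le
  nlinarith
end
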